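/- Let ‖·‖_Y be a Haar system Hardy space norm and let n ∈ ℕ₀. Then for every Haar multiplier M : Y_n → Y_n with entries (m_I)_{I∈D_{≤n}}, the operator norm satisfies ‖M − m_{[0,1)}·I_{Y_n}‖ ≤ Σ_{k=1}^n max_{I∈D_k} |m_I − m_{[0,1)}|. -/

import Mathlib

open MeasureTheory

noncomputable section

/-- A dyadic interval `[i/2^j, (i+1)/2^j) ⊆ [0,1)` (0-based position `i < 2^j`). -/
structure DyadicInt where
  j : ℕ
  i : ℕ
  hi : i < 2 ^ j

noncomputable instance : DecidableEq DyadicInt := Classical.decEq _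

namespace DyadicInt

/-- The underlying set of the dyadic interval. -/
def set (I : DyadicInt) : Set ℝ :=
  Set.Ico ((I.i : ℝ) / 2 ^ I.j) (((I.i : ℝ) + 1) / 2 ^ I.j)

/-- `|I|`, the length of the dyadic interval. -/
def len (I : DyadicInt) : ℝ := 1 / 2 ^ I.j

/-- The left half `I⁺` of `I`. -/
def left (I : DyadicInt) : DyadicInt :=
  ⟨I.j + 1, 2 * I.i, by have := I.hi; simp only [pow_succ]; omega⟩

/-- The right half `I⁻` of `I`. -/
def right (I : DyadicInt) : DyadicInt :=
  ⟨I.j + 1, 2 * I.i + 1, by have := I.hi; simp only [pow_succ]; omega⟩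

/-- The root interval `[0,1)`. -/
def root : DyadicInt := ⟨0, 0, Nat.one_pos⟩

end DyadicInt

/-- The Haar function `h_I = χ_{I⁺} − χ_{I⁻}`. -/
def haar (I : DyadicInt) : ℝ → ℝ :=
  fun s => I.left.set.indicator 1 s - I.right.set.indicator 1 s

/-- `χ_{[0,1)}`. -/
def unitChi : ℝ → ℝ := (Set.Ico (0 : ℝ) 1).indicator 1

/-- The Rademacher function `r_k = Σ_{I ∈ D_k} h_I`. -/
def rademacher (k : ℕ) : ℝ → ℝ :=
  fun s => ∑ i : Fin (2 ^ k), haar ⟨k, i.1, i.2⟩ s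

/-- The collection `D_k` of dyadic intervals of length `2^{-k}`, as a finset. -/
def Dk (k : ℕ) : Finset DyadicInt :=
  (Finset.univ : Finset (Fin (2 ^ k))).image fun i => ⟨k, i.1, i.2⟩

lemma Dk_nonempty (k : ℕ) : (Dk k).Nonempty :=
  ⟨⟨k, 0, Nat.two_pow_pos k⟩,
    Finset.mem_image.2 ⟨⟨0, Nat.two_pow_pos k⟩, Finset.mem_univ _, rfl⟩⟩

/-- The collection `D_{≤ n}`, as a finset. -/
def DleF (n : ℕ) : Finset DyadicInt := (Finset.range (n + 1)).biUnion Dk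

/-- `H`: the linear span of the Haar functions together with `χ_{[0,1)}`. -/
def Hspace : Submodule ℝ (ℝ → ℝ) :=
  Submodule.span ℝ (Set.range haar ∪ {unitChi})

/-- `H₀`: the linear span of the Haar functions. -/
def H0space : Submodule ℝ (ℝ → ℝ) := Submodule.span ℝ (Set.range haar)

/-- `|f|` and `|g|` have the same distribution w.r.t. Lebesgue measure on `[0,1)`. -/
def SameDist (f g : ℝ → ℝ) : Prop :=
  ∀ t : ℝ, volume {s ∈ Set.Ico (0 : ℝ) 1 | t < |f s|}
    = volume {s ∈ Set.Ico (0 : ℝ) 1 | t < |g s|}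

/-- `⟨f, g⟩ = ∫₀¹ f(s) g(s) ds`. -/
def pairing (f g : ℝ → ℝ) : ℝ := ∫ s in Set.Ico (0 : ℝ) 1, f s * g s

/-- A Haar system space norm: a rearrangement-invariant norm on `H`
with `‖χ_{[0,1)}‖ = 1`. -/
structure HaarSystemSpaceNorm where
  normX : (ℝ → ℝ) → ℝ
  nonneg : ∀ f ∈ Hspace, 0 ≤ normX f
  definite : ∀ f ∈ Hspace, normX f = 0 → f = 0
  smul : ∀ (c : ℝ), ∀ f ∈ Hspace, normX (c • f) = |c| * normX f
  triangle : ∀ f ∈ Hspace, ∀ g ∈ Hspace, normX (f + g) ≤ normX f + normX g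
  rearrangement : ∀ f ∈ Hspace, ∀ g ∈ Hspace, SameDist f g → normX f = normX g
  chi_norm : normX unitChi = 1

/-- A Haar system Hardy space norm `‖·‖_Y` on `H₀`, built from a Haar system space
norm `‖·‖_X` and a choice of Rademacher family `r` (either constant `r_0`, or the
independent family `r_{ι(I)}`). -/
structure HaarHardyNorm extends HaarSystemSpaceNorm where
  r : DyadicInt → ℝ → ℝ
  r_spec : (∀ I, r I = rademacher 0) ∨ (∀ I, r I = rademacher (2 ^ I.j + I.i))
  normY : (ℝ → ℝ) → ℝ
  normY_spec : ∀ a : DyadicInt → ℝ, (Function.support a).Finite →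
    normY (fun s => ∑ᶠ I, a I * haar I s)
      = normX (fun s => ∫ u in Set.Ico (0 : ℝ) 1, |∑ᶠ I, r I u * (a I * haar I s)|)

/-- `Y_n`: the linear span of `{h_I : I ∈ D_{≤ n}}`. -/
def Yspan (n : ℕ) : Submodule ℝ (ℝ → ℝ) :=
  Submodule.span ℝ (haar '' {I : DyadicInt | I.j ≤ n})

/-- `h_I` as an element of `Y_N`. -/
def haarY (N : ℕ) (I : DyadicInt) (h : I.j ≤ N) : Yspan N :=
  ⟨haar I, Submodule.subset_span ⟨I, h, rfl⟩⟩

/-- The operator norm (induced by `‖·‖_Y`) of a linear map `Y_n → Y_m`. -/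
def opNorm (nm : HaarHardyNorm) {n m : ℕ} (T : Yspan n →ₗ[ℝ] Yspan m) : ℝ :=
  sInf {C : ℝ | 0 ≤ C ∧ ∀ x : Yspan n, nm.normY (T x).1 ≤ C * nm.normY x.1}

/-- `S` factors through `T` with constant `C` (and error `0`). -/
def Factors (nm : HaarHardyNorm) {n N : ℕ} (S : Yspan n →ₗ[ℝ] Yspan n)
    (T : Yspan N →ₗ[ℝ] Yspan N) (C : ℝ) : Prop :=
  ∃ (B : Yspan n →ₗ[ℝ] Yspan N) (A : Yspan N →ₗ[ℝ] Yspan n),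
    opNorm nm A * opNorm nm B ≤ C ∧ S = A ∘ₗ T ∘ₗ B

/-- `S` factors through `T` with constant `C` and error `η`. -/
def FactorsErr (nm : HaarHardyNorm) {n N : ℕ} (S : Yspan n →ₗ[ℝ] Yspan n)
    (T : Yspan N →ₗ[ℝ] Yspan N) (C η : ℝ) : Prop :=
  ∃ (B : Yspan n →ₗ[ℝ] Yspan N) (A : Yspan N →ₗ[ℝ] Yspan n),
    opNorm nm A * opNorm nm B ≤ C ∧ opNorm nm (S - A ∘ₗ T ∘ₗ B) ≤ η

/-- `S` projectionally factors through `T` with constant `C` and error `η`. -/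
def ProjFactorsErr (nm : HaarHardyNorm) {n N : ℕ} (S : Yspan n →ₗ[ℝ] Yspan n)
    (T : Yspan N →ₗ[ℝ] Yspan N) (C η : ℝ) : Prop :=
  ∃ (B : Yspan n →ₗ[ℝ] Yspan N) (A : Yspan N →ₗ[ℝ] Yspan n),
    opNorm nm A * opNorm nm B ≤ C ∧ opNorm nm (S - A ∘ₗ T ∘ₗ B) ≤ η ∧
      A ∘ₗ B = LinearMap.id

/-- `T : Y_N → Y_N` has `δ`-large positive diagonal. -/
def LargePosDiag (δ : ℝ) {N : ℕ} (T : Yspan N →ₗ[ℝ] Yspan N) : Prop :=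
  ∀ (I : DyadicInt) (h : I.j ≤ N), δ * I.len ≤ pairing (haar I) (T (haarY N I h)).1

/-- `T : Y_N → Y_N` has `δ`-large diagonal. -/
def LargeDiag (δ : ℝ) {N : ℕ} (T : Yspan N →ₗ[ℝ] Yspan N) : Prop :=
  ∀ (I : DyadicInt) (h : I.j ≤ N), δ * I.len ≤ |pairing (haar I) (T (haarY N I h)).1|

/-- The Haar system is `K`-unconditional in `Y`. -/
def Unconditional (nm : HaarHardyNorm) (K : ℝ) : Prop :=
  ∀ a ε : DyadicInt → ℝ, (Function.support a).Finite → (∀ I, ε I = 1 ∨ ε I = -1) →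
    nm.normY (fun s => ∑ᶠ I, ε I * a I * haar I s)
      ≤ K * nm.normY (fun s => ∑ᶠ I, a I * haar I s)

/-- The dual norm `‖y‖_{Y*} = sup { ⟨y, x⟩ : x ∈ H₀, ‖x‖_Y ≤ 1 }`. -/
def dualNorm (nm : HaarHardyNorm) (y : ℝ → ℝ) : ℝ :=
  sSup {c : ℝ | ∃ x ∈ H0space, nm.normY x ≤ 1 ∧ c = pairing y x}

/-- `|B^*|`: the Lebesgue measure of the union of a finite collection of
dyadic intervals. -/
def starMeas (Bf : Finset DyadicInt) : ℝ := (volume (⋃ K ∈ Bf, K.set)).toReal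

/-- The function on `[0,1)` equal to `F i` on the `i`-th dyadic interval of length `2^{-N}`,
extended by zero. -/
def dyadicStep (N : ℕ) (F : ℕ → ℝ) : ℝ → ℝ :=
  fun s => if s ∈ Set.Ico (0 : ℝ) 1 then F ⌊s * 2 ^ N⌋₊ else 0

lemma dyadicStep_of_mem {s : ℝ} (hs : s ∈ Set.Ico (0 : ℝ) 1) (N : ℕ) (F : ℕ → ℝ) :
    dyadicStep N F s = F ⌊s * 2 ^ N⌋₊ := if_pos hs

lemma dyadicStep_of_notMem {s : ℝ} (hs : s ∉ Set.Ico (0 : ℝ) 1) (N : ℕ) (F : ℕ → ℝ) :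
    dyadicStep N F s = 0 := if_neg hs

lemma floor_mul_two_pow_lt {s : ℝ} (hs : s ∈ Set.Ico (0 : ℝ) 1) (N : ℕ) :
    ⌊s * 2 ^ N⌋₊ < 2 ^ N := by
  have h2 : (0 : ℝ) < 2 ^ N := by positivity
  rw [Nat.floor_lt (mul_nonneg hs.1 h2.le)]
  push_cast
  nlinarith [hs.2]

lemma floor_mul_two_pow_succ (s : ℝ) (N : ℕ) :
    ⌊s * 2 ^ (N + 1)⌋₊ / 2 = ⌊s * 2 ^ N⌋₊ := by
  have h := Nat.floor_div_natCast (s * 2 ^ (N + 1)) 2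
  rw [← h]
  congr 1
  push_cast
  rw [pow_succ]
  ring

lemma mem_dyadic_cell_iff {s : ℝ} (hs : 0 ≤ s) (N l : ℕ) :
    s ∈ Set.Ico ((l : ℝ) / 2 ^ N) (((l : ℝ) + 1) / 2 ^ N) ↔ ⌊s * 2 ^ N⌋₊ = l := by
  have h2 : (0 : ℝ) < 2 ^ N := by positivity
  rw [Nat.floor_eq_iff (mul_nonneg hs h2.le), Set.mem_Ico, div_le_iff₀ h2, lt_div_iff₀ h2]

lemma dyadic_cell_subset {N l : ℕ} (hl : l < 2 ^ N) :
    Set.Ico ((l : ℝ) / 2 ^ N) (((l : ℝ) + 1) / 2 ^ N) ⊆ Set.Ico (0 : ℝ) 1 := by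
  have h2 : (0 : ℝ) < 2 ^ N := by positivity
  have hl' : (l : ℝ) + 1 ≤ 2 ^ N := by exact_mod_cast hl
  exact Set.Ico_subset_Ico (by positivity) ((div_le_one h2).2 hl')

lemma indicator_dyadic_cell {N l : ℕ} (hl : l < 2 ^ N) (s c : ℝ) :
    (Set.Ico ((l : ℝ) / 2 ^ N) (((l : ℝ) + 1) / 2 ^ N)).indicator (fun _ => c) s
      = dyadicStep N (fun i => if i = l then c else 0) s := by
  by_cases hs : s ∈ Set.Ico (0 : ℝ) 1
  · rw [dyadicStep_of_mem hs, Set.indicator_apply]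
    simp only [mem_dyadic_cell_iff hs.1]
  · rw [dyadicStep_of_notMem hs, Set.indicator_of_notMem]
    exact fun h => hs (dyadic_cell_subset hl h)

lemma dyadicStep_congr {N : ℕ} {F G : ℕ → ℝ} (h : ∀ i < 2 ^ N, F i = G i) :
    dyadicStep N F = dyadicStep N G := by
  funext s
  by_cases hs : s ∈ Set.Ico (0 : ℝ) 1
  · rw [dyadicStep_of_mem hs, dyadicStep_of_mem hs, h _ (floor_mul_two_pow_lt hs N)]
  · rw [dyadicStep_of_notMem hs, dyadicStep_of_notMem hs]

lemma dyadicStep_add (N : ℕ) (F G : ℕ → ℝ) :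
    dyadicStep N (fun i => F i + G i) = dyadicStep N F + dyadicStep N G := by
  funext s
  by_cases hs : s ∈ Set.Ico (0 : ℝ) 1 <;> simp [dyadicStep, hs]

lemma dyadicStep_smul (N : ℕ) (c : ℝ) (F : ℕ → ℝ) :
    dyadicStep N (fun i => c * F i) = c • dyadicStep N F := by
  funext s
  by_cases hs : s ∈ Set.Ico (0 : ℝ) 1 <;> simp [dyadicStep, hs]

lemma dyadicStep_mul (N : ℕ) (F G : ℕ → ℝ) (s : ℝ) :
    dyadicStep N (fun i => F i * G i) s = dyadicStep N F s * dyadicStep N G s := by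
  by_cases hs : s ∈ Set.Ico (0 : ℝ) 1 <;> simp [dyadicStep, hs]

lemma dyadicStep_sum {ι : Type*} (N : ℕ) (S : Finset ι) (F : ι → ℕ → ℝ) :
    dyadicStep N (fun i => ∑ x ∈ S, F x i) = ∑ x ∈ S, dyadicStep N (F x) := by
  funext s
  by_cases hs : s ∈ Set.Ico (0 : ℝ) 1 <;> simp [dyadicStep, hs, Finset.sum_apply]

lemma dyadicStep_succ (N : ℕ) (F : ℕ → ℝ) :
    dyadicStep N F = dyadicStep (N + 1) (fun i => F (i / 2)) := by
  funext s
  by_cases hs : s ∈ Set.Ico (0 : ℝ) 1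
  · rw [dyadicStep_of_mem hs, dyadicStep_of_mem hs, floor_mul_two_pow_succ]
  · rw [dyadicStep_of_notMem hs, dyadicStep_of_notMem hs]

lemma exists_dyadicStep_of_le {N N' : ℕ} (h : N ≤ N') (F : ℕ → ℝ) :
    ∃ G, dyadicStep N F = dyadicStep N' G := by
  induction N', h using Nat.le_induction with
  | base => exact ⟨F, rfl⟩
  | succ K _ ih =>
    obtain ⟨G, hG⟩ := ih
    exact ⟨_, hG.trans (dyadicStep_succ K G)⟩

lemma dyadicStep_eq_sum (N : ℕ) (F : ℕ → ℝ) :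
    dyadicStep N F = fun s => ∑ l ∈ Finset.range (2 ^ N),
      (Set.Ico ((l : ℝ) / 2 ^ N) (((l : ℝ) + 1) / 2 ^ N)).indicator (fun _ => F l) s := by
  funext s
  rw [Finset.sum_congr rfl fun l hl => indicator_dyadic_cell (Finset.mem_range.1 hl) s (F l)]
  by_cases hs : s ∈ Set.Ico (0 : ℝ) 1
  · simp [dyadicStep_of_mem hs, floor_mul_two_pow_lt hs N]
  · simp [dyadicStep_of_notMem hs]

lemma integrableOn_dyadicStep (N : ℕ) (F : ℕ → ℝ) :
    IntegrableOn (dyadicStep N F) (Set.Ico (0 : ℝ) 1) := by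
  rw [dyadicStep_eq_sum]
  refine integrable_finsetSum _ fun l _ => ?_
  refine Integrable.indicator ?_ measurableSet_Ico
  exact integrableOn_const (by simp)

lemma setIntegral_dyadicStep (N : ℕ) (F : ℕ → ℝ) :
    ∫ s in Set.Ico (0 : ℝ) 1, dyadicStep N F s
      = (∑ l ∈ Finset.range (2 ^ N), F l) / 2 ^ N := by
  rw [dyadicStep_eq_sum, integral_finsetSum]
  · rw [Finset.sum_div]
    refine Finset.sum_congr rfl fun l hl => ?_
    rw [setIntegral_indicator measurableSet_Ico,
      Set.inter_eq_self_of_subset_right (dyadic_cell_subset (Finset.mem_range.1 hl)),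
      setIntegral_const, Measure.real, Real.volume_Ico, ENNReal.toReal_ofReal]
    · rw [smul_eq_mul]
      ring
    · rw [← sub_div]
      simp
  · intro l _
    refine Integrable.indicator ?_ measurableSet_Ico
    exact integrableOn_const (by simp)

lemma measurable_dyadicStep (N : ℕ) (F : ℕ → ℝ) : Measurable (dyadicStep N F) := by
  rw [dyadicStep_eq_sum]
  exact Finset.measurable_fun_sum _ fun l _ => measurable_const.indicator measurableSet_Ico

/-- Two step functions whose absolute values satisfy the same counting statistics are
equidistributed. -/
lemma sameDist_dyadicStep {N : ℕ} {F G : ℕ → ℝ}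
    (h : ∀ φ : ℝ → ℝ, ∑ l ∈ Finset.range (2 ^ N), φ |F l| = ∑ l ∈ Finset.range (2 ^ N), φ |G l|) :
    SameDist (dyadicStep N F) (dyadicStep N G) := by
  intro t
  have key : ∀ F : ℕ → ℝ, volume.real {s ∈ Set.Ico (0 : ℝ) 1 | t < |dyadicStep N F s|}
      = (∑ l ∈ Finset.range (2 ^ N), (if t < |F l| then (1 : ℝ) else 0)) / 2 ^ N := by
    intro F
    have hm : MeasurableSet {s : ℝ | t < |dyadicStep N F s|} :=
      measurableSet_lt measurable_const (measurable_dyadicStep N F).abs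
    rw [← setIntegral_dyadicStep N (fun l => if t < |F l| then (1 : ℝ) else 0)]
    have h1 : ∀ s ∈ Set.Ico (0 : ℝ) 1,
        dyadicStep N (fun l => if t < |F l| then (1 : ℝ) else 0) s
          = {s : ℝ | t < |dyadicStep N F s|}.indicator (fun _ => 1) s := by
      intro s hs
      rw [dyadicStep_of_mem hs]
      simp [Set.indicator_apply, dyadicStep_of_mem hs]
    rw [setIntegral_congr_fun measurableSet_Ico h1, setIntegral_indicator hm, setIntegral_const,
      smul_eq_mul, mul_one]
    rfl
  have hfin : ∀ F : ℕ → ℝ, volume {s ∈ Set.Ico (0 : ℝ) 1 | t < |dyadicStep N F s|} ≠ ⊤ :=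
    fun F => measure_ne_top_of_subset (Set.sep_subset _ _) (by simp)
  rw [← measureReal_eq_measureReal_iff (hfin F) (hfin G), key, key,
    h fun y => if t < y then (1 : ℝ) else 0]

lemma sum_range_two_mul (φ : ℕ → ℝ) (m : ℕ) :
    ∑ i ∈ Finset.range (2 * m), φ i = ∑ i ∈ Finset.range m, (φ (2 * i) + φ (2 * i + 1)) := by
  induction m with
  | zero => simp
  | succ m ih =>
    rw [show 2 * (m + 1) = 2 * m + 1 + 1 by ring, Finset.sum_range_succ, Finset.sum_range_succ,
      Finset.sum_range_succ, ih]
    ring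

lemma haar_eq_dyadicStep (I : DyadicInt) :
    haar I = dyadicStep (I.j + 1) (fun i => if i / 2 = I.i then (-1) ^ i else 0) := by
  funext s
  have hl := indicator_dyadic_cell I.left.hi s 1
  have hr := indicator_dyadic_cell I.right.hi s 1
  change I.left.set.indicator 1 s - I.right.set.indicator 1 s = _
  change I.left.set.indicator 1 s = dyadicStep (I.j + 1) _ s at hl
  change I.right.set.indicator 1 s = dyadicStep (I.j + 1) _ s at hr
  rw [hl, hr]
  by_cases hs : s ∈ Set.Ico (0 : ℝ) 1
  · rw [dyadicStep_of_mem hs, dyadicStep_of_mem hs, dyadicStep_of_mem hs]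
    generalize ⌊s * 2 ^ (I.j + 1)⌋₊ = i
    change (if i = 2 * I.i then (1 : ℝ) else 0) - (if i = 2 * I.i + 1 then (1 : ℝ) else 0) = _
    rcases Nat.even_or_odd' i with ⟨k, rfl | rfl⟩
    · have h1 : 2 * k ≠ 2 * I.i + 1 := by omega
      simp [h1]
    · have h1 : 2 * k + 1 ≠ 2 * I.i := by omega
      have h2 : (2 * k + 1) / 2 = k := by omega
      simp only [h2]
      by_cases h : k = I.i <;> simp [h, h1, pow_succ]
  · simp [dyadicStep_of_notMem hs]

lemma rademacher_eq_dyadicStep (k : ℕ) :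
    rademacher k = dyadicStep (k + 1) (fun i => (-1) ^ i) := by
  funext s
  unfold rademacher
  simp only [haar_eq_dyadicStep]
  by_cases hs : s ∈ Set.Ico (0 : ℝ) 1
  · simp only [dyadicStep_of_mem hs]
    have hlt := floor_mul_two_pow_lt hs (k + 1)
    generalize ⌊s * 2 ^ (k + 1)⌋₊ = i at hlt
    have hi : i / 2 < 2 ^ k := by rw [pow_succ] at hlt; omega
    rw [Finset.sum_eq_single (⟨i / 2, hi⟩ : Fin (2 ^ k))]
    · simp
    · intro b _ hb
      rw [if_neg]
      exact fun h => hb (Fin.ext h.symm)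
    · simp
  · simp [dyadicStep_of_notMem hs]

lemma unitChi_eq_dyadicStep : unitChi = dyadicStep 0 (fun _ => 1) := by
  funext s
  simp [unitChi, dyadicStep, Set.indicator_apply]

lemma mem_Dk {k : ℕ} {I : DyadicInt} : I ∈ Dk k ↔ I.j = k := by
  unfold Dk
  rw [Finset.mem_image]
  constructor
  · rintro ⟨i, -, rfl⟩
    rfl
  · rintro rfl
    exact ⟨⟨I.i, I.hi⟩, Finset.mem_univ _, rfl⟩

lemma mem_DleF {n : ℕ} {I : DyadicInt} : I ∈ DleF n ↔ I.j ≤ n := by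
  simp [DleF, mem_Dk]

lemma sum_DleF (n : ℕ) (φ : DyadicInt → ℝ) :
    ∑ I ∈ DleF n, φ I = ∑ k ∈ Finset.range (n + 1), ∑ I ∈ Dk k, φ I := by
  refine Finset.sum_biUnion fun k _ l _ hkl => ?_
  refine Finset.disjoint_left.2 fun I hk hl => hkl ?_
  rw [← mem_Dk.1 hk, mem_Dk.1 hl]

lemma dyadicStep_mem_Hspace (N : ℕ) (F : ℕ → ℝ) : dyadicStep N F ∈ Hspace := by
  induction N generalizing F with
  | zero =>
    have h : dyadicStep 0 F = F 0 • unitChi := by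
      rw [unitChi_eq_dyadicStep, ← dyadicStep_smul]
      refine dyadicStep_congr fun i hi => ?_
      obtain rfl : i = 0 := by simpa using hi
      simp
    rw [h]
    exact Submodule.smul_mem _ _ (Submodule.subset_span (Or.inr rfl))
  | succ N ih =>
    have h : dyadicStep (N + 1) F
        = dyadicStep N (fun i => (F (2 * i) + F (2 * i + 1)) / 2)
          + ∑ I ∈ Dk N, ((F (2 * I.i) - F (2 * I.i + 1)) / 2) • haar I := by
      have h2 : ∀ I ∈ Dk N, ((F (2 * I.i) - F (2 * I.i + 1)) / 2) • haar I
          = dyadicStep (N + 1) (fun i => (F (2 * I.i) - F (2 * I.i + 1)) / 2 *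
            (if i / 2 = I.i then (-1) ^ i else 0)) := by
        intro I hI
        rw [dyadicStep_smul, haar_eq_dyadicStep, mem_Dk.1 hI]
      rw [Finset.sum_congr rfl h2, ← dyadicStep_sum, dyadicStep_succ N, ← dyadicStep_add]
      refine dyadicStep_congr fun i hi => ?_
      have hi2 : i / 2 < 2 ^ N := by rw [pow_succ] at hi; omega
      rw [Finset.sum_eq_single (⟨N, i / 2, hi2⟩ : DyadicInt)]
      · rcases Nat.even_or_odd' i with ⟨k, rfl | rfl⟩
        · simp
          ring
        · have h3 : (2 * k + 1) / 2 = k := by omega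
          simp [h3, pow_succ]
          ring
      · intro J hJ hne
        rw [if_neg, mul_zero]
        intro h
        obtain ⟨j, l, hl⟩ := J
        obtain rfl : j = N := mem_Dk.1 hJ
        subst h
        exact hne rfl
      · intro h
        exact absurd (mem_Dk.2 rfl) h
    rw [h]
    refine Submodule.add_mem _ (ih _) (Submodule.sum_mem _ fun I _ => ?_)
    exact Submodule.smul_mem _ _ (Submodule.subset_span (Or.inl ⟨I, rfl⟩))

namespace HaarSystemSpaceNorm

variable (X : HaarSystemSpaceNorm)

lemma normX_sum_le {ι : Type*} (S : Finset ι) (f : ι → ℝ → ℝ) (hf : ∀ x ∈ S, f x ∈ Hspace) :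
    X.normX (∑ x ∈ S, f x) ≤ ∑ x ∈ S, X.normX (f x) := by
  classical
  induction S using Finset.induction_on with
  | empty =>
    have h := X.smul 0 0 (Submodule.zero_mem _)
    rw [smul_zero, abs_zero, zero_mul] at h
    simp [h]
  | insert x S hx ih =>
    rw [Finset.sum_insert hx, Finset.sum_insert hx]
    have hS : ∀ y ∈ S, f y ∈ Hspace := fun y hy => hf y (Finset.mem_insert_of_mem hy)
    exact (X.triangle _ (hf x (Finset.mem_insert_self x S)) _
      (Submodule.sum_mem _ hS)).trans (by gcongr; exact ih hS)

lemma normX_dyadicStep_congr_abs {N : ℕ} {F G : ℕ → ℝ} (h : ∀ i, |F i| = |G i|) :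
    X.normX (dyadicStep N F) = X.normX (dyadicStep N G) :=
  X.rearrangement _ (dyadicStep_mem_Hspace N F) _ (dyadicStep_mem_Hspace N G)
    (sameDist_dyadicStep fun φ => by simp [h])

/-- Shrinking a single value of a step function does not increase its norm. -/
lemma normX_dyadicStep_update_le (N : ℕ) (F : ℕ → ℝ) (m : ℕ) {θ : ℝ} (hθ : |θ| ≤ 1) :
    X.normX (dyadicStep N (Function.update F m (θ * F m))) ≤ X.normX (dyadicStep N F) := by
  obtain ⟨h1, h2⟩ := abs_le.1 hθ
  have hdec : dyadicStep N (Function.update F m (θ * F m))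
      = ((1 + θ) / 2) • dyadicStep N F
        + ((1 - θ) / 2) • dyadicStep N (Function.update F m (-F m)) := by
    rw [← dyadicStep_smul, ← dyadicStep_smul, ← dyadicStep_add]
    congr 1
    funext i
    by_cases hi : i = m
    · subst hi
      simp only [Function.update_self]
      ring
    · simp only [Function.update_of_ne hi]
      ring
  have hflip : X.normX (dyadicStep N (Function.update F m (-F m)))
      = X.normX (dyadicStep N F) := by
    refine X.normX_dyadicStep_congr_abs fun i => ?_
    by_cases hi : i = m
    · subst hi
      simp
    · simp [Function.update_of_ne hi]
  rw [hdec]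
  refine (X.triangle _ (Submodule.smul_mem _ _ (dyadicStep_mem_Hspace _ _)) _
    (Submodule.smul_mem _ _ (dyadicStep_mem_Hspace _ _))).trans ?_
  rw [X.smul _ _ (dyadicStep_mem_Hspace _ _), X.smul _ _ (dyadicStep_mem_Hspace _ _), hflip,
    abs_of_nonneg (by linarith), abs_of_nonneg (by linarith)]
  exact le_of_eq (by ring)

lemma normX_dyadicStep_mul_le (N : ℕ) (F θ : ℕ → ℝ) (hθ : ∀ i, |θ i| ≤ 1) :
    X.normX (dyadicStep N (fun i => θ i * F i)) ≤ X.normX (dyadicStep N F) := by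
  have key : ∀ m, X.normX (dyadicStep N (fun i => if i < m then θ i * F i else F i))
      ≤ X.normX (dyadicStep N F) := by
    intro m
    induction m with
    | zero => simp
    | succ m ih =>
      refine le_trans (le_of_eq ?_) ((X.normX_dyadicStep_update_le N _ m (hθ m)).trans ih)
      congr 2
      funext i
      rcases lt_trichotomy i m with h | rfl | h
      · simp [Function.update_of_ne h.ne, h, h.trans m.lt_succ_self]
      · simp
      · simp [Function.update_of_ne h.ne', h.not_gt, show ¬ i < m + 1 by omega]
  have h := key (2 ^ N)
  rwa [dyadicStep_congr (G := fun i => θ i * F i) (fun i hi => if_pos hi)] at h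

lemma normX_dyadicStep_mono {N : ℕ} {F G : ℕ → ℝ} (h : ∀ i, |F i| ≤ |G i|) :
    X.normX (dyadicStep N F) ≤ X.normX (dyadicStep N G) := by
  have hF : F = fun i => F i / G i * G i := by
    funext i
    by_cases hi : G i = 0
    · have h0 := h i
      rw [hi, abs_zero] at h0
      simp [hi, abs_nonpos_iff.1 h0]
    · rw [div_mul_cancel₀ _ hi]
  rw [hF]
  refine X.normX_dyadicStep_mul_le N G _ fun i => ?_
  rw [abs_div]
  exact div_le_one_of_le₀ (h i) (abs_nonneg _)

/-- Monotonicity of the norm on functions that are step functions of some dyadic level. -/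
lemma normX_mono {N N' : ℕ} {F G : ℕ → ℝ}
    (h : ∀ s ∈ Set.Ico (0 : ℝ) 1, |dyadicStep N F s| ≤ |dyadicStep N' G s|) :
    X.normX (dyadicStep N F) ≤ X.normX (dyadicStep N' G) := by
  obtain ⟨F', hF⟩ := exists_dyadicStep_of_le (le_max_left N N') F
  obtain ⟨G', hG⟩ := exists_dyadicStep_of_le (le_max_right N N') G
  rw [hF, hG] at h ⊢
  set K := max N N'
  have h2 : (0 : ℝ) < 2 ^ K := by positivity
  rw [dyadicStep_congr (F := F') (G := fun i => if i < 2 ^ K then F' i else 0)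
      fun i hi => (if_pos hi).symm,
    dyadicStep_congr (F := G') (G := fun i => if i < 2 ^ K then G' i else 0)
      fun i hi => (if_pos hi).symm]
  refine X.normX_dyadicStep_mono fun i => ?_
  by_cases hi : i < 2 ^ K
  · have hs : (i : ℝ) / 2 ^ K ∈ Set.Ico (0 : ℝ) 1 := by
      refine ⟨by positivity, (div_lt_one h2).2 ?_⟩
      exact_mod_cast hi
    have hfl : ⌊(i : ℝ) / 2 ^ K * 2 ^ K⌋₊ = i := by
      rw [div_mul_cancel₀ _ h2.ne', Nat.floor_natCast]
    have := h _ hs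
    rw [dyadicStep_of_mem hs, dyadicStep_of_mem hs, hfl] at this
    simpa [hi] using this
  · simp [hi]

/-- Exchanging the halves of every dyadic interval of level `k` shows that the sign of the
top-level part may be reversed. -/
lemma normX_sub_eq_normX_add (k : ℕ) (G L : ℕ → ℝ) (hL : ∀ i, L (2 * i + 1) = -L (2 * i)) :
    X.normX (dyadicStep k G - dyadicStep (k + 1) L)
      = X.normX (dyadicStep k G + dyadicStep (k + 1) L) := by
  have hneg : dyadicStep k G - dyadicStep (k + 1) L
      = dyadicStep (k + 1) (fun i => G (i / 2) + -1 * L i) := by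
    rw [dyadicStep_add, dyadicStep_smul, dyadicStep_succ k G, sub_eq_add_neg, neg_one_smul]
  rw [hneg, dyadicStep_succ k G, ← dyadicStep_add]
  refine X.rearrangement _ (dyadicStep_mem_Hspace _ _) _ (dyadicStep_mem_Hspace _ _)
    (sameDist_dyadicStep fun φ => ?_)
  rw [pow_succ, mul_comm, sum_range_two_mul, sum_range_two_mul]
  refine Finset.sum_congr rfl fun i _ => ?_
  have h1 : (2 * i + 1) / 2 = i := by omega
  have h2 : 2 * i / 2 = i := by omega
  simp only [h1, h2, hL]
  rw [add_comm]
  congr 3 <;> ring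

lemma normX_le_normX_add (k : ℕ) (G L : ℕ → ℝ) (hL : ∀ i, L (2 * i + 1) = -L (2 * i)) :
    X.normX (dyadicStep k G) ≤ X.normX (dyadicStep k G + dyadicStep (k + 1) L) ∧
    X.normX (dyadicStep (k + 1) L) ≤ X.normX (dyadicStep k G + dyadicStep (k + 1) L) := by
  set g := dyadicStep k G with hg
  set l := dyadicStep (k + 1) L with hl
  have hgm : g ∈ Hspace := dyadicStep_mem_Hspace _ _
  have hlm : l ∈ Hspace := dyadicStep_mem_Hspace _ _
  have hflip : X.normX (g - l) = X.normX (g + l) := X.normX_sub_eq_normX_add k G L hL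
  have hflip' : X.normX ((-1 : ℝ) • (g - l)) = X.normX (g + l) := by
    rw [X.smul _ _ (Submodule.sub_mem _ hgm hlm), hflip]
    simp
  have h1 := X.triangle _ (Submodule.add_mem _ hgm hlm) _ (Submodule.sub_mem _ hgm hlm)
  have h2 := X.triangle _ (Submodule.add_mem _ hgm hlm) _
    (Submodule.smul_mem _ (-1 : ℝ) (Submodule.sub_mem _ hgm hlm))
  rw [show g + l + (g - l) = (2 : ℝ) • g by rw [two_smul]; abel, X.smul _ _ hgm, hflip,
    abs_two] at h1
  rw [show g + l + (-1 : ℝ) • (g - l) = (2 : ℝ) • l by rw [two_smul, neg_one_smul]; abel,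
    X.smul _ _ hlm, hflip', abs_two] at h2
  constructor <;> linarith

end HaarSystemSpaceNorm

/-- The part of the Haar expansion with coefficients `a` at level `k`. -/
def haarLevel (a : DyadicInt → ℝ) (k : ℕ) : ℝ → ℝ := ∑ I ∈ Dk k, a I • haar I

lemma haarLevel_eq_dyadicStep (a : DyadicInt → ℝ) (k : ℕ) :
    ∃ L : ℕ → ℝ, (∀ i, L (2 * i + 1) = -L (2 * i)) ∧ haarLevel a k = dyadicStep (k + 1) L := by
  refine ⟨fun i => ∑ I ∈ Dk k, a I * (if i / 2 = I.i then (-1) ^ i else 0), fun i => ?_, ?_⟩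
  · have h1 : (2 * i + 1) / 2 = i := by omega
    simp only [h1, ← Finset.sum_neg_distrib]
    refine Finset.sum_congr rfl fun I _ => ?_
    by_cases h : i = I.i <;> simp [h, pow_succ]
  · rw [dyadicStep_sum]
    refine Finset.sum_congr rfl fun I hI => ?_
    rw [dyadicStep_smul, haar_eq_dyadicStep, mem_Dk.1 hI]

/-- At each point of `[0,1)` exactly one Haar function of each level is nonzero. -/
lemma exists_haar_of_mem {s : ℝ} (hs : s ∈ Set.Ico (0 : ℝ) 1) (k : ℕ) :
    ∃ I ∈ Dk k, |haar I s| = 1 ∧ ∀ J ∈ Dk k, J ≠ I → haar J s = 0 := by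
  have hlt := floor_mul_two_pow_lt hs (k + 1)
  have hi : ⌊s * 2 ^ (k + 1)⌋₊ / 2 < 2 ^ k := by rw [pow_succ] at hlt ⊢; omega
  refine ⟨⟨k, _, hi⟩, mem_Dk.2 rfl, ?_, ?_⟩
  · rw [haar_eq_dyadicStep, dyadicStep_of_mem hs]
    simp
  · rintro ⟨j, l, hl⟩ hJ hne
    obtain rfl : j = k := mem_Dk.1 hJ
    rw [haar_eq_dyadicStep, dyadicStep_of_mem hs, if_neg]
    intro h
    exact hne (by simp only [h])

lemma haar_of_notMem {s : ℝ} (hs : s ∉ Set.Ico (0 : ℝ) 1) (I : DyadicInt) : haar I s = 0 := by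
  rw [haar_eq_dyadicStep, dyadicStep_of_notMem hs]

lemma sum_abs_haar_eq_abs_haarLevel (a : DyadicInt → ℝ) (k : ℕ) (s : ℝ) :
    ∑ I ∈ Dk k, |a I * haar I s| = |haarLevel a k s| := by
  simp only [haarLevel, Finset.sum_apply, Pi.smul_apply, smul_eq_mul]
  by_cases hs : s ∈ Set.Ico (0 : ℝ) 1
  · obtain ⟨I, hI, -, h0⟩ := exists_haar_of_mem hs k
    rw [Finset.sum_eq_single_of_mem I hI fun J hJ hne => by rw [h0 J hJ hne]; simp,
      Finset.sum_eq_single_of_mem I hI fun J hJ hne => by rw [h0 J hJ hne]; simp]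
  · simp [haar_of_notMem hs]

lemma sum_haarLevel_eq_dyadicStep (a : DyadicInt → ℝ) (m : ℕ) :
    ∃ G : ℕ → ℝ, ∑ k ∈ Finset.range m, haarLevel a k = dyadicStep m G := by
  induction m with
  | zero => exact ⟨fun _ => 0, by funext s; simp [dyadicStep]⟩
  | succ m ih =>
    obtain ⟨G, hG⟩ := ih
    obtain ⟨L, -, hL⟩ := haarLevel_eq_dyadicStep a m
    exact ⟨_, by rw [Finset.sum_range_succ, hG, hL, dyadicStep_succ m G, ← dyadicStep_add]⟩

lemma HaarSystemSpaceNorm.normX_haarLevel_le (X : HaarSystemSpaceNorm) (a : DyadicInt → ℝ)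
    {k m : ℕ} (hkm : k < m) :
    X.normX (haarLevel a k) ≤ X.normX (∑ l ∈ Finset.range m, haarLevel a l) := by
  induction m, hkm using Nat.le_induction with
  | base =>
    obtain ⟨G, hG⟩ := sum_haarLevel_eq_dyadicStep a k
    obtain ⟨L, hL, hL'⟩ := haarLevel_eq_dyadicStep a k
    rw [Finset.sum_range_succ, hG, hL']
    exact (X.normX_le_normX_add k G L hL).2
  | succ m _ ih =>
    refine ih.trans ?_
    obtain ⟨G, hG⟩ := sum_haarLevel_eq_dyadicStep a m
    obtain ⟨L, hL, hL'⟩ := haarLevel_eq_dyadicStep a m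
    rw [Finset.sum_range_succ, hG, hL']
    exact (X.normX_le_normX_add m G L hL).1

lemma abs_rademacher {u : ℝ} (hu : u ∈ Set.Ico (0 : ℝ) 1) (k : ℕ) : |rademacher k u| = 1 := by
  rw [rademacher_eq_dyadicStep, dyadicStep_of_mem hu]
  simp

lemma setIntegral_rademacher_mul_of_lt {k l : ℕ} (h : k < l) :
    ∫ u in Set.Ico (0 : ℝ) 1, rademacher k u * rademacher l u = 0 := by
  obtain ⟨F, hF⟩ := exists_dyadicStep_of_le (Nat.succ_le_of_lt h) (fun i => (-1 : ℝ) ^ i)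
  rw [rademacher_eq_dyadicStep, rademacher_eq_dyadicStep, hF, dyadicStep_succ]
  simp only [← dyadicStep_mul]
  rw [setIntegral_dyadicStep, pow_succ, mul_comm, sum_range_two_mul, Finset.sum_eq_zero, zero_div]
  intro i _
  have h1 : (2 * i + 1) / 2 = i := by omega
  simp [h1, pow_succ]

lemma setIntegral_rademacher_mul (k l : ℕ) :
    ∫ u in Set.Ico (0 : ℝ) 1, rademacher k u * rademacher l u = if k = l then 1 else 0 := by
  rcases lt_trichotomy k l with h | rfl | h
  · rw [setIntegral_rademacher_mul_of_lt h, if_neg h.ne]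
  · have h1 : ∀ u ∈ Set.Ico (0 : ℝ) 1, rademacher k u * rademacher k u = 1 := fun u hu => by
      rw [← abs_mul_abs_self, abs_rademacher hu, one_mul]
    rw [setIntegral_congr_fun measurableSet_Ico h1]
    simp
  · simp only [mul_comm (rademacher k _)]
    rw [setIntegral_rademacher_mul_of_lt h, if_neg h.ne']

lemma integrableOn_rademacher_mul (k l : ℕ) :
    IntegrableOn (fun u => rademacher k u * rademacher l u) (Set.Ico (0 : ℝ) 1) := by
  obtain ⟨F, hF⟩ := exists_dyadicStep_of_le (le_max_left (k + 1) (l + 1)) (fun i => (-1 : ℝ) ^ i)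
  obtain ⟨G, hG⟩ := exists_dyadicStep_of_le (le_max_right (k + 1) (l + 1)) (fun i => (-1 : ℝ) ^ i)
  rw [rademacher_eq_dyadicStep, rademacher_eq_dyadicStep, hF, hG]
  simp only [← dyadicStep_mul]
  exact integrableOn_dyadicStep _ _

lemma two_pow_add_injective {I J : DyadicInt} (h : 2 ^ I.j + I.i = 2 ^ J.j + J.i) : I = J := by
  have aux : ∀ I J : DyadicInt, I.j < J.j → 2 ^ I.j + I.i ≠ 2 ^ J.j + J.i := by
    intro I J hlt
    have h1 : 2 ^ (I.j + 1) ≤ 2 ^ J.j := Nat.pow_le_pow_right two_pos hlt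
    have h2 := I.hi
    rw [pow_succ] at h1
    omega
  rcases lt_trichotomy I.j J.j with hlt | heq | hlt
  · exact absurd h (aux I J hlt)
  · obtain ⟨j, i, hi⟩ := I
    obtain ⟨j', i', hi'⟩ := J
    obtain rfl : j = j' := heq
    obtain rfl : i = i' := Nat.add_left_cancel h
    rfl
  · exact absurd h.symm (aux J I hlt)

namespace HaarHardyNorm

variable (nm : HaarHardyNorm)

/-- The function `s ↦ ∫₀¹ |Σ_{I ∈ D_{≤n}} r_I(u) a_I h_I(s)| du` whose `X`-norm is the `Y`-norm
of `Σ_{I ∈ D_{≤n}} a_I h_I`. -/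
def squareFun (n : ℕ) (a : DyadicInt → ℝ) : ℝ → ℝ :=
  fun s => ∫ u in Set.Ico (0 : ℝ) 1, |∑ I ∈ DleF n, nm.r I u * (a I * haar I s)|

lemma normY_sum (n : ℕ) (a : DyadicInt → ℝ) :
    nm.normY (∑ I ∈ DleF n, a I • haar I) = nm.normX (nm.squareFun n a) := by
  set b : DyadicInt → ℝ := fun I => if I ∈ DleF n then a I else 0 with hb
  have hsupp : Function.support b ⊆ ↑(DleF n) := by
    intro I hI
    by_contra h
    exact hI (if_neg h)
  have h := nm.normY_spec b ((DleF n).finite_toSet.subset hsupp)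
  have e1 : (fun s => ∑ᶠ I, b I * haar I s) = ∑ I ∈ DleF n, a I • haar I := by
    funext s
    rw [finsum_eq_sum_of_support_subset (s := DleF n)]
    · rw [Finset.sum_apply]
      refine Finset.sum_congr rfl fun I hI => ?_
      simp [hb, hI]
    · exact (Function.support_mul_subset_left _ _).trans hsupp
  have e2 : (fun s => ∫ u in Set.Ico (0 : ℝ) 1, |∑ᶠ I, nm.r I u * (b I * haar I s)|)
      = nm.squareFun n a := by
    funext s
    unfold squareFun
    congr 1
    funext u
    rw [finsum_eq_sum_of_support_subset (s := DleF n)]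
    · congr 1
      refine Finset.sum_congr rfl fun I hI => ?_
      simp [hb, hI]
    · exact ((Function.support_mul_subset_right _ _).trans
        (Function.support_mul_subset_left _ _)).trans hsupp
  rwa [e1, e2] at h

lemma exists_r_eq_rademacher (I : DyadicInt) : ∃ k, nm.r I = rademacher k := by
  rcases nm.r_spec with h | h
  · exact ⟨_, h I⟩
  · exact ⟨_, h I⟩

lemma abs_r {u : ℝ} (hu : u ∈ Set.Ico (0 : ℝ) 1) (I : DyadicInt) : |nm.r I u| = 1 := by
  obtain ⟨k, hk⟩ := nm.exists_r_eq_rademacher I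
  rw [hk, abs_rademacher hu]

lemma squareFun_nonneg (n : ℕ) (a : DyadicInt → ℝ) (s : ℝ) : 0 ≤ nm.squareFun n a s :=
  integral_nonneg fun _ => abs_nonneg _

lemma squareFun_eq_dyadicStep (n : ℕ) (a : DyadicInt → ℝ) :
    ∃ F, nm.squareFun n a = dyadicStep (n + 1) F := by
  have h : ∀ I : DyadicInt, ∃ H, I.j ≤ n → haar I = dyadicStep (n + 1) H := fun I => by
    by_cases hI : I.j ≤ n
    · obtain ⟨H, hH⟩ := exists_dyadicStep_of_le (Nat.succ_le_succ hI)
        (fun i => if i / 2 = I.i then (-1 : ℝ) ^ i else 0)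
      exact ⟨H, fun _ => (haar_eq_dyadicStep I).trans hH⟩
    · exact ⟨0, fun h => absurd h hI⟩
  choose H hH using h
  refine ⟨fun i => ∫ u in Set.Ico (0 : ℝ) 1, |∑ I ∈ DleF n, nm.r I u * (a I * H I i)|, ?_⟩
  funext s
  by_cases hs : s ∈ Set.Ico (0 : ℝ) 1
  · rw [dyadicStep_of_mem hs]
    unfold squareFun
    congr 1
    funext u
    congr 1
    refine Finset.sum_congr rfl fun I hI => ?_
    rw [hH I (mem_DleF.1 hI), dyadicStep_of_mem hs]
  · simp [squareFun, dyadicStep_of_notMem hs, haar_of_notMem hs]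

lemma squareFun_le (n : ℕ) (a : DyadicInt → ℝ) (s : ℝ) :
    nm.squareFun n a s ≤ ∑ k ∈ Finset.range (n + 1), |haarLevel a k s| := by
  have hbound : ∀ u ∈ Set.Ico (0 : ℝ) 1,
      ‖|∑ I ∈ DleF n, nm.r I u * (a I * haar I s)|‖
        ≤ ∑ k ∈ Finset.range (n + 1), |haarLevel a k s| := by
    intro u hu
    rw [Real.norm_eq_abs, abs_abs]
    refine (Finset.abs_sum_le_sum_abs _ _).trans (le_of_eq ?_)
    rw [sum_DleF]
    refine Finset.sum_congr rfl fun k _ => ?_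
    rw [← sum_abs_haar_eq_abs_haarLevel]
    refine Finset.sum_congr rfl fun I _ => ?_
    rw [abs_mul, nm.abs_r hu, one_mul]
  have h := norm_setIntegral_le_of_norm_le_const (μ := volume) (s := Set.Ico (0 : ℝ) 1)
    (by simp) hbound
  simp only [Measure.real, Real.volume_Ico, sub_zero, ENNReal.ofReal_one, ENNReal.toReal_one,
    mul_one] at h
  exact (le_abs_self _).trans h

lemma squareFun_eq_abs_of_const (h : ∀ I, nm.r I = rademacher 0) (n : ℕ) (a : DyadicInt → ℝ)
    (s : ℝ) : nm.squareFun n a s = |(∑ k ∈ Finset.range (n + 1), haarLevel a k) s| := by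
  have h1 : ∀ u ∈ Set.Ico (0 : ℝ) 1, |∑ I ∈ DleF n, nm.r I u * (a I * haar I s)|
      = |(∑ k ∈ Finset.range (n + 1), haarLevel a k) s| := by
    intro u hu
    simp only [h]
    rw [← Finset.mul_sum, abs_mul, abs_rademacher hu, one_mul, sum_DleF]
    simp [haarLevel, Finset.sum_apply]
  unfold squareFun
  rw [setIntegral_congr_fun measurableSet_Ico h1]
  simp

lemma abs_haarLevel_le_squareFun_of_indep (h : ∀ I, nm.r I = rademacher (2 ^ I.j + I.i)) {n k : ℕ}
    (hk : k ≤ n) (a : DyadicInt → ℝ) (s : ℝ) : |haarLevel a k s| ≤ nm.squareFun n a s := by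
  by_cases hs : s ∈ Set.Ico (0 : ℝ) 1
  swap
  · rw [← sum_abs_haar_eq_abs_haarLevel]
    simpa [haar_of_notMem hs] using nm.squareFun_nonneg n a s
  obtain ⟨I, hI, -, h0⟩ := exists_haar_of_mem hs k
  rw [← sum_abs_haar_eq_abs_haarLevel,
    Finset.sum_eq_single_of_mem I hI fun J hJ hne => by rw [h0 J hJ hne]; simp]
  have hIn : I ∈ DleF n := mem_DleF.2 ((mem_Dk.1 hI).trans_le hk)
  have hint : ∫ u in Set.Ico (0 : ℝ) 1,
      nm.r I u * ∑ J ∈ DleF n, nm.r J u * (a J * haar J s) = a I * haar I s := by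
    simp only [Finset.mul_sum, ← mul_assoc, h]
    simp only [mul_assoc _ (a _)]
    rw [integral_finsetSum _ fun J _ => (integrableOn_rademacher_mul _ _).mul_const _]
    simp only [integral_mul_const, setIntegral_rademacher_mul]
    rw [Finset.sum_eq_single_of_mem I hIn]
    · simp
    · intro J _ hne
      rw [if_neg fun e => hne (two_pow_add_injective e).symm, zero_mul]
  rw [← hint]
  refine abs_integral_le_integral_abs.trans (le_of_eq ?_)
  refine setIntegral_congr_fun measurableSet_Ico fun u hu => ?_
  simp only [abs_mul, nm.abs_r hu, one_mul]

/-- Projecting onto a single level of the Haar system is a contraction. -/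
lemma normX_haarLevel_le_squareFun {n k : ℕ} (hk : k ≤ n) (a : DyadicInt → ℝ) :
    nm.normX (haarLevel a k) ≤ nm.normX (nm.squareFun n a) := by
  obtain ⟨F, hF⟩ := nm.squareFun_eq_dyadicStep n a
  rcases nm.r_spec with h | h
  · refine (nm.normX_haarLevel_le a (Nat.lt_succ_of_le hk)).trans ?_
    obtain ⟨G, hG⟩ := sum_haarLevel_eq_dyadicStep a (n + 1)
    rw [hG, hF]
    refine nm.normX_mono fun s _ => ?_
    rw [← hG, ← hF, nm.squareFun_eq_abs_of_const h, abs_abs]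
  · obtain ⟨L, -, hL⟩ := haarLevel_eq_dyadicStep a k
    rw [hL, hF]
    refine nm.normX_mono fun s _ => ?_
    rw [← hL, ← hF]
    exact (nm.abs_haarLevel_le_squareFun_of_indep h hk a s).trans (le_abs_self _)

/-- Coefficientwise multiplication by `c` is bounded by the sum of level-wise bounds for `c`. -/
lemma normX_squareFun_mul_le (n : ℕ) (a c : DyadicInt → ℝ) (C : ℕ → ℝ)
    (hC : ∀ k, ∀ I ∈ Dk k, |c I| ≤ C k) :
    nm.normX (nm.squareFun n fun I => c I * a I)
      ≤ (∑ k ∈ Finset.range (n + 1), C k) * nm.normX (nm.squareFun n a) := by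
  have hC0 : ∀ k, 0 ≤ C k := fun k =>
    (abs_nonneg _).trans (hC k _ (Dk_nonempty k).choose_spec)
  choose L _ hL using haarLevel_eq_dyadicStep a
  have habs : ∀ k s, |haarLevel a k s| = dyadicStep (k + 1) (fun i => |L k i|) s := by
    intro k s
    rw [hL]
    by_cases hs : s ∈ Set.Ico (0 : ℝ) 1 <;> simp [dyadicStep, hs]
  have hH : ∀ k ∈ Finset.range (n + 1),
      C k • dyadicStep (k + 1) (fun i => |L k i|) ∈ Hspace :=
    fun k _ => Submodule.smul_mem _ _ (dyadicStep_mem_Hspace _ _)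
  have hstep : ∀ k, ∃ G, k ≤ n →
      C k • dyadicStep (k + 1) (fun i => |L k i|) = dyadicStep (n + 1) G := fun k => by
    by_cases hk : k ≤ n
    · rw [← dyadicStep_smul]
      obtain ⟨G, hG⟩ := exists_dyadicStep_of_le (Nat.succ_le_succ hk) (fun i => C k * |L k i|)
      exact ⟨G, fun _ => hG⟩
    · exact ⟨0, fun h => absurd h hk⟩
  choose G hG using hstep
  have hsum : ∑ k ∈ Finset.range (n + 1), C k • dyadicStep (k + 1) (fun i => |L k i|)
      = dyadicStep (n + 1) (fun i => ∑ k ∈ Finset.range (n + 1), G k i) := by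
    rw [dyadicStep_sum]
    exact Finset.sum_congr rfl fun k hk => hG k (Nat.lt_succ_iff.1 (Finset.mem_range.1 hk))
  have hlev : ∀ k s, |haarLevel (fun I => c I * a I) k s| ≤ C k * |haarLevel a k s| := by
    intro k s
    rw [← sum_abs_haar_eq_abs_haarLevel, ← sum_abs_haar_eq_abs_haarLevel, Finset.mul_sum]
    refine Finset.sum_le_sum fun I hI => ?_
    rw [mul_assoc, abs_mul]
    exact mul_le_mul_of_nonneg_right (hC k I hI) (abs_nonneg _)
  calc nm.normX (nm.squareFun n fun I => c I * a I)
      ≤ nm.normX (∑ k ∈ Finset.range (n + 1), C k • dyadicStep (k + 1) (fun i => |L k i|)) := by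
        obtain ⟨F, hF⟩ := nm.squareFun_eq_dyadicStep n (fun I => c I * a I)
        rw [hsum, hF]
        refine nm.normX_mono fun s _ => ?_
        rw [← hF, ← hsum, abs_of_nonneg (nm.squareFun_nonneg _ _ _)]
        refine ((nm.squareFun_le _ _ _).trans (Finset.sum_le_sum fun k _ => hlev k s)).trans
          (le_trans (le_of_eq ?_) (le_abs_self _))
        simp [habs, Finset.sum_apply]
    _ ≤ ∑ k ∈ Finset.range (n + 1),
          nm.normX (C k • dyadicStep (k + 1) (fun i => |L k i|)) := nm.normX_sum_le _ _ hH
    _ ≤ ∑ k ∈ Finset.range (n + 1), C k * nm.normX (nm.squareFun n a) := by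
        refine Finset.sum_le_sum fun k hk => ?_
        rw [nm.smul _ _ (dyadicStep_mem_Hspace _ _), abs_of_nonneg (hC0 k)]
        refine mul_le_mul_of_nonneg_left ?_ (hC0 k)
        rw [nm.normX_dyadicStep_congr_abs (G := L k) fun i => abs_abs _, ← hL]
        exact nm.normX_haarLevel_le_squareFun (Nat.lt_succ_iff.1 (Finset.mem_range.1 hk)) a
    _ = _ := (Finset.sum_mul _ _ _).symm

end HaarHardyNorm

lemma exists_eq_sum_of_mem_Yspan {n : ℕ} {f : ℝ → ℝ} (hf : f ∈ Yspan n) :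
    ∃ a : DyadicInt → ℝ, f = ∑ I ∈ DleF n, a I • haar I := by
  have hset : {I : DyadicInt | I.j ≤ n} = ↑(DleF n) := by
    ext I
    simp [mem_DleF]
  unfold Yspan at hf
  rw [hset, Submodule.mem_span_image_finset_iff_exists_fun] at hf
  obtain ⟨a, ha⟩ := hf
  refine ⟨fun I => if h : I ∈ DleF n then a ⟨I, h⟩ else 0, ?_⟩
  rw [← ha, ← Finset.sum_attach (DleF n)]
  simp

/-- norm estimate for Haar multipliers. -/
theorem statement7 (nm : HaarHardyNorm) (n : ℕ)
    (M : Yspan n →ₗ[ℝ] Yspan n) (m : DyadicInt → ℝ)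
    (hM : ∀ (I : DyadicInt) (h : I.j ≤ n), M (haarY n I h) = m I • haarY n I h) :
    opNorm nm (M - m DyadicInt.root • LinearMap.id)
      ≤ ∑ k ∈ Finset.Icc 1 n,
          (Dk k).sup' (Dk_nonempty k) (fun I => |m I - m DyadicInt.root|) := by
  let C : ℕ → ℝ := fun k => (Dk k).sup' (Dk_nonempty k) (fun I => |m I - m DyadicInt.root|)
  have hC : ∀ k, ∀ I ∈ Dk k, |m I - m DyadicInt.root| ≤ C k := fun k I hI =>
    Finset.le_sup' (fun I => |m I - m DyadicInt.root|) hI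
  have hC0 : C 0 = 0 := by
    refine le_antisymm (Finset.sup'_le _ _ fun I hI => ?_)
      ((abs_nonneg _).trans (hC 0 _ (Dk_nonempty 0).choose_spec))
    obtain ⟨j, i, hi⟩ := I
    obtain rfl : j = 0 := mem_Dk.1 hI
    obtain rfl : i = 0 := by simpa using hi
    simp [DyadicInt.root]
  have hsum : ∑ k ∈ Finset.range (n + 1), C k = ∑ k ∈ Finset.Icc 1 n, C k := by
    rw [Finset.range_eq_Ico, Finset.sum_eq_sum_Ico_succ_bot (Nat.succ_pos n), hC0, zero_add]
    rfl
  refine csInf_le ⟨0, fun _ h => h.1⟩ ⟨Finset.sum_nonneg fun k _ =>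
    (abs_nonneg _).trans (hC k _ (Dk_nonempty k).choose_spec), fun x => ?_⟩
  obtain ⟨a, ha⟩ := exists_eq_sum_of_mem_Yspan x.2
  have hx : x = ∑ I ∈ (DleF n).attach, a I.1 • haarY n I.1 (mem_DleF.1 I.2) := by
    refine Subtype.ext ?_
    rw [ha, ← Finset.sum_attach]
    simp [haarY]
  have hTx : ((M - m DyadicInt.root • LinearMap.id : Yspan n →ₗ[ℝ] Yspan n) x).1
      = ∑ I ∈ DleF n, ((m I - m DyadicInt.root) * a I) • haar I := by
    rw [hx, map_sum, ← Finset.sum_attach (DleF n)]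
    simp only [map_smul, LinearMap.sub_apply, LinearMap.smul_apply, LinearMap.id_apply, hM]
    simp [haarY, mul_comm _ (a _), mul_smul, sub_smul]
  rw [hTx, ha, nm.normY_sum, nm.normY_sum, ← hsum]
  exact nm.normX_squareFun_mul_le n a _ C hC
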